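/- Let a > 0 and let s be a real number with s > −4a. Then (1/Γ(a)²) ∫₀^∞ ∫₀^∞ (√x + √y)^s x^{a−1} y^{a−1} e^{−x−y} dx dy = [Γ(2a + s/2)/Γ(2a)] · [Γ(a+1/2)/(Γ(a)Γ(1/2))] · ∫₀^1 u^{a−1}(1−u)^{−1/2}(1+√u)^{s/2} du. (This is the Mellin-transform form of the identity in law √Γ_a + √Γ_a = √(Γ_{2a} × (1 + √B_{a,1/2})).) -/

import Mathlib

open MeasureTheory Set

/-- The beta density is integrable on the unit interval. -/
lemma integrableOn_rpow_mul_one_sub_rpow {a b : ℝ} (ha : 0 < a) (hb : 0 < b) :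
    IntegrableOn (fun u : ℝ => u ^ (a - 1) * (1 - u) ^ (b - 1)) (Ioo 0 1) := by
  have h := Complex.betaIntegral_convergent (u := a) (v := b) (by simpa) (by simpa)
  rw [intervalIntegrable_iff_integrableOn_Ioo_of_le zero_le_one] at h
  refine IntegrableOn.congr_fun h.norm (fun u hu => ?_) measurableSet_Ioo
  have hu1 : 0 < 1 - u := sub_pos.2 hu.2
  have e : (1 - (u : ℂ)) = ((1 - u : ℝ) : ℂ) := by push_cast; ring
  rw [norm_mul, e, Complex.norm_cpow_eq_rpow_re_of_pos hu.1,
    Complex.norm_cpow_eq_rpow_re_of_pos hu1]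
  simp

lemma integrableOn_beta_mul_one_add_sqrt_rpow {a : ℝ} (ha : 0 < a) (c : ℝ) :
    IntegrableOn (fun u : ℝ => u ^ (a - 1) * (1 - u) ^ (-(1 / 2) : ℝ) * (1 + √u) ^ c)
      (Ioo 0 1) := by
  have h := integrableOn_rpow_mul_one_sub_rpow ha (b := 1 / 2) (by norm_num)
  rw [show (1 / 2 - 1 : ℝ) = -(1 / 2) by norm_num] at h
  have hc : ContinuousOn (fun u : ℝ => (1 + √u) ^ c) (Icc 0 1) := by
    refine ContinuousOn.rpow_const (by fun_prop) fun u _ => Or.inl ?_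
    positivity
  rw [← integrableOn_Icc_iff_integrableOn_Ioo] at h ⊢
  exact h.mul_continuousOn hc isCompact_Icc

/-- The derivative of the map `v ↦ 4v / (1 + v)²`. -/
lemma hasDerivAt_four_mul_div_one_add_sq {v : ℝ} (hv : 0 < v) :
    HasDerivAt (fun v : ℝ => 4 * v / (1 + v) ^ 2) (4 * (1 - v) / (1 + v) ^ 3) v := by
  have h1 : (1 + v) ≠ 0 := by positivity
  have h := ((hasDerivAt_id v).const_mul 4).div (((hasDerivAt_id v).const_add 1).pow 2)
    (pow_ne_zero 2 h1)
  refine h.congr_deriv ?_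
  simp only [id, Nat.cast_ofNat, Pi.pow_apply]
  field_simp
  ring

lemma eq_or_mul_eq_one_of_four_mul_div {v w : ℝ} (hv : 0 < v) (hw : 0 < w)
    (h : 4 * v / (1 + v) ^ 2 = 4 * w / (1 + w) ^ 2) : v = w ∨ v * w = 1 := by
  rw [div_eq_div_iff (by positivity) (by positivity)] at h
  have h0 : (v - w) * (1 - v * w) = 0 := by linarith
  rcases mul_eq_zero.1 h0 with h | h
  · exact Or.inl (by linarith)
  · exact Or.inr (by linarith)

lemma injOn_four_mul_div_Ioo : InjOn (fun v : ℝ => 4 * v / (1 + v) ^ 2) (Ioo 0 1) := by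
  intro v hv w hw h
  refine (eq_or_mul_eq_one_of_four_mul_div hv.1 hw.1 h).resolve_right fun h1 => ?_
  nlinarith [hv.1, hv.2, hw.1, hw.2]

lemma injOn_four_mul_div_Ioi : InjOn (fun v : ℝ => 4 * v / (1 + v) ^ 2) (Ioi 1) := by
  intro v (hv : 1 < v) w (hw : 1 < w) h
  refine (eq_or_mul_eq_one_of_four_mul_div (by linarith) (by linarith) h).resolve_right
    fun h1 => ?_
  nlinarith

lemma four_mul_div_mem_Ioo {v : ℝ} (hv : 0 < v) (hv1 : v ≠ 1) :
    4 * v / (1 + v) ^ 2 ∈ Ioo (0 : ℝ) 1 := by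
  refine ⟨by positivity, (div_lt_one (by positivity)).2 ?_⟩
  have : 0 < (v - 1) ^ 2 := by
    have := sub_ne_zero.2 hv1
    positivity
  linarith

lemma sqrt_one_sub_mem_Ioo {u : ℝ} (hu : u ∈ Ioo (0 : ℝ) 1) : √(1 - u) ∈ Ioo (0 : ℝ) 1 :=
  ⟨Real.sqrt_pos.2 (sub_pos.2 hu.2), (Real.sqrt_lt' one_pos).2 (by linarith [hu.1])⟩

lemma image_four_mul_div_Ioo :
    (fun v : ℝ => 4 * v / (1 + v) ^ 2) '' Ioo 0 1 = Ioo 0 1 := by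
  refine Subset.antisymm (image_subset_iff.2 fun v hv => four_mul_div_mem_Ioo hv.1 hv.2.ne)
    fun u hu => ?_
  obtain ⟨h0, h1⟩ := sqrt_one_sub_mem_Ioo hu
  have hsq := Real.sq_sqrt (sub_nonneg.2 hu.2.le)
  set w := √(1 - u)
  have hw : 0 < 1 - w := by linarith
  refine ⟨(1 - w) / (1 + w), ⟨by positivity, (div_lt_one (by positivity)).2 (by linarith)⟩, ?_⟩
  have : 1 + (1 - w) / (1 + w) = 2 / (1 + w) := by field_simp; ring
  simp only [this]
  field_simp
  linarith

lemma image_four_mul_div_Ioi :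
    (fun v : ℝ => 4 * v / (1 + v) ^ 2) '' Ioi 1 = Ioo 0 1 := by
  refine Subset.antisymm (image_subset_iff.2 fun v (hv : 1 < v) =>
    four_mul_div_mem_Ioo (by linarith) hv.ne') fun u hu => ?_
  obtain ⟨h0, h1⟩ := sqrt_one_sub_mem_Ioo hu
  have hsq := Real.sq_sqrt (sub_nonneg.2 hu.2.le)
  set w := √(1 - u)
  have hw : 0 < 1 - w := by linarith
  refine ⟨(1 + w) / (1 - w), (one_lt_div hw).2 (by linarith), ?_⟩
  have : 1 + (1 + w) / (1 - w) = 2 / (1 - w) := by field_simp; ring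
  simp only [this]
  field_simp
  linarith

/-- The integrand of the beta integral pulled back along `v ↦ 4v / (1 + v)²`. -/
lemma abs_deriv_mul_beta_comp_four_mul_div (a c : ℝ) {v : ℝ} (hv : 0 < v) (hv1 : v ≠ 1) :
    |4 * (1 - v) / (1 + v) ^ 3| •
      ((4 * v / (1 + v) ^ 2) ^ (a - 1) * (1 - 4 * v / (1 + v) ^ 2) ^ (-(1 / 2) : ℝ)
        * (1 + √(4 * v / (1 + v) ^ 2)) ^ c)
      = 4 ^ a * (v ^ (a - 1) * (1 + √v) ^ (2 * c) * (1 + v) ^ (-(2 * a + c))) := by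
  have hp : 0 < 1 + v := by positivity
  have hd : 0 < |1 - v| := abs_pos.2 (sub_ne_zero.2 hv1.symm)
  have e1 : 1 - 4 * v / (1 + v) ^ 2 = (|1 - v| / (1 + v)) ^ 2 := by
    rw [div_pow, sq_abs]; field_simp; ring
  have e2 : (1 - 4 * v / (1 + v) ^ 2) ^ (-(1 / 2) : ℝ) = (1 + v) / |1 - v| := by
    rw [e1, Real.rpow_neg (by positivity), ← Real.sqrt_eq_rpow, Real.sqrt_sq (by positivity),
      inv_div]
  have e3 : 1 + √(4 * v / (1 + v) ^ 2) = (1 + √v) ^ 2 / (1 + v) := by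
    rw [Real.sqrt_div (by positivity), Real.sqrt_sq hp.le, Real.sqrt_mul (by norm_num),
      show (4 : ℝ) = 2 ^ 2 by norm_num, Real.sqrt_sq (by norm_num)]
    have := Real.sq_sqrt hv.le
    field_simp
    linarith
  have e4 : |4 * (1 - v) / (1 + v) ^ 3| = 4 * |1 - v| / (1 + v) ^ 3 := by
    rw [abs_div, abs_mul, abs_of_pos (pow_pos hp 3), abs_of_pos (by norm_num : (0 : ℝ) < 4)]
  have e5 : (1 + v) ^ (-(2 * a + c))
      = ((1 + v) ^ 2)⁻¹ * (((1 + v) ^ 2) ^ (a - 1))⁻¹ * ((1 + v) ^ c)⁻¹ := by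
    rw [← Real.rpow_natCast, ← Real.rpow_mul hp.le, ← Real.rpow_neg hp.le, ← Real.rpow_neg hp.le,
      ← Real.rpow_neg hp.le, ← Real.rpow_add hp, ← Real.rpow_add hp]
    congr 1
    push_cast
    ring
  have e6 : (1 + √v) ^ (2 * c) = ((1 + √v) ^ 2) ^ c := by
    rw [← Real.rpow_natCast, ← Real.rpow_mul (by positivity)]
    norm_num
  rw [e2, e3, e4, e5, e6, Real.div_rpow (by positivity) (by positivity),
    Real.div_rpow (by positivity) (by positivity), Real.mul_rpow (by norm_num) hv.le,
    Real.rpow_sub_one (by norm_num : (4 : ℝ) ≠ 0), smul_eq_mul]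
  field_simp

lemma integrableOn_and_integral_of_image {a : ℝ} (ha : 0 < a) (c : ℝ) {S : Set ℝ}
    (hS : MeasurableSet S) (hpos : ∀ v ∈ S, 0 < v ∧ v ≠ 1)
    (hinj : InjOn (fun v : ℝ => 4 * v / (1 + v) ^ 2) S)
    (himg : (fun v : ℝ => 4 * v / (1 + v) ^ 2) '' S = Ioo 0 1) :
    IntegrableOn (fun v : ℝ => v ^ (a - 1) * (1 + √v) ^ (2 * c) * (1 + v) ^ (-(2 * a + c))) S ∧
    ∫ v in S, v ^ (a - 1) * (1 + √v) ^ (2 * c) * (1 + v) ^ (-(2 * a + c))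
      = (4 ^ a)⁻¹ * ∫ u in Ioo (0 : ℝ) 1,
          u ^ (a - 1) * (1 - u) ^ (-(1 / 2) : ℝ) * (1 + √u) ^ c := by
  have hder : ∀ v ∈ S, HasDerivWithinAt (fun v : ℝ => 4 * v / (1 + v) ^ 2)
      (4 * (1 - v) / (1 + v) ^ 3) S v := fun v hv =>
    (hasDerivAt_four_mul_div_one_add_sq (hpos v hv).1).hasDerivWithinAt
  have h4 : (4 : ℝ) ^ a ≠ 0 := by positivity
  have hcongr := fun v (hv : v ∈ S) =>
    abs_deriv_mul_beta_comp_four_mul_div a c (hpos v hv).1 (hpos v hv).2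
  constructor
  · have h := integrableOn_beta_mul_one_add_sqrt_rpow ha c
    rw [← himg, integrableOn_image_iff_integrableOn_abs_deriv_smul hS hder hinj] at h
    exact (integrable_const_mul_iff h4.isUnit _).1 (h.congr_fun hcongr hS)
  · rw [← himg, integral_image_eq_integral_abs_deriv_smul hS hder hinj,
      setIntegral_congr_fun hS hcongr, integral_const_mul, inv_mul_cancel_left₀ h4]

lemma integrableOn_and_integral_Ioi {a : ℝ} (ha : 0 < a) (c : ℝ) :
    IntegrableOn (fun v : ℝ => v ^ (a - 1) * (1 + √v) ^ (2 * c) * (1 + v) ^ (-(2 * a + c)))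
      (Ioi 0) ∧
    ∫ v in Ioi (0 : ℝ), v ^ (a - 1) * (1 + √v) ^ (2 * c) * (1 + v) ^ (-(2 * a + c))
      = 2 * (4 ^ a)⁻¹ * ∫ u in Ioo (0 : ℝ) 1,
          u ^ (a - 1) * (1 - u) ^ (-(1 / 2) : ℝ) * (1 + √u) ^ c := by
  obtain ⟨i1, e1⟩ := integrableOn_and_integral_of_image ha c measurableSet_Ioo
    (fun v hv => ⟨hv.1, hv.2.ne⟩) injOn_four_mul_div_Ioo image_four_mul_div_Ioo
  obtain ⟨i2, e2⟩ := integrableOn_and_integral_of_image ha c measurableSet_Ioi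
    (fun v (hv : 1 < v) => ⟨by linarith, hv.ne'⟩) injOn_four_mul_div_Ioi image_four_mul_div_Ioi
  rw [← integrableOn_Ioc_iff_integrableOn_Ioo] at i1
  rw [← integral_Ioc_eq_integral_Ioo] at e1
  rw [← Ioc_union_Ioi_eq_Ioi zero_le_one]
  refine ⟨i1.union i2, ?_⟩
  rw [setIntegral_union (Ioc_disjoint_Ioi le_rfl) measurableSet_Ioi i1 i2, e1, e2]
  ring

/-- The substitution `y = x v` in the inner integral. -/
lemma inner_integral_eq (a s : ℝ) {x : ℝ} (hx : 0 < x) :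
    ∫ y in Ioi (0 : ℝ), (√x + √y) ^ s * x ^ (a - 1) * y ^ (a - 1) * Real.exp (-x - y)
      = ∫ v in Ioi (0 : ℝ), v ^ (a - 1) * (1 + √v) ^ s
          * (x ^ (2 * a + s / 2 - 1) * Real.exp (-((1 + v) * x))) := by
  have h := integral_comp_mul_left_Ioi
    (fun y => (√x + √y) ^ s * x ^ (a - 1) * y ^ (a - 1) * Real.exp (-x - y)) 0 hx
  rw [mul_zero, eq_inv_smul_iff₀ hx.ne', smul_eq_mul, ← integral_const_mul] at h
  rw [← h]
  refine setIntegral_congr_fun measurableSet_Ioi fun v (hv : 0 < v) => ?_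
  have e1 : √x + √(x * v) = √x * (1 + √v) := by rw [Real.sqrt_mul hx.le]; ring
  have e2 : √x ^ s = x ^ (s / 2) := by
    rw [Real.sqrt_eq_rpow, ← Real.rpow_mul hx.le]; congr 1; ring
  have e3 : x ^ (2 * a + s / 2 - 1) = x * x ^ (s / 2) * x ^ (a - 1) * x ^ (a - 1) := by
    nth_rewrite 2 [← Real.rpow_one x]
    rw [← Real.rpow_add hx, ← Real.rpow_add hx, ← Real.rpow_add hx]
    congr 1; ring
  have e4 : -x - x * v = -((1 + v) * x) := by ring
  simp only [e1, e3, e4]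
  rw [Real.mul_rpow (by positivity) (by positivity), e2, Real.mul_rpow hx.le hv.le]
  ring

/-- The double integral reduces to a one-dimensional integral over the ratio of the variables. -/
lemma double_integral_eq {a s : ℝ} (ha : 0 < a) (hs : -4 * a < s) :
    ∫ x in Ioi (0 : ℝ), ∫ y in Ioi (0 : ℝ),
        (√x + √y) ^ s * x ^ (a - 1) * y ^ (a - 1) * Real.exp (-x - y)
      = Real.Gamma (2 * a + s / 2) * ∫ v in Ioi (0 : ℝ),
          v ^ (a - 1) * (1 + √v) ^ (2 * (s / 2)) * (1 + v) ^ (-(2 * a + s / 2)) := by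
  have hb : 0 < 2 * a + s / 2 := by linarith
  have hG := Real.Gamma_pos_of_pos hb
  have hgamma : ∀ v : ℝ, 0 < v →
      ∫ x in Ioi (0 : ℝ), v ^ (a - 1) * (1 + √v) ^ s
          * (x ^ (2 * a + s / 2 - 1) * Real.exp (-((1 + v) * x)))
        = Real.Gamma (2 * a + s / 2) *
          (v ^ (a - 1) * (1 + √v) ^ (2 * (s / 2)) * (1 + v) ^ (-(2 * a + s / 2))) := by
    intro v hv
    have hv1 : 0 < 1 + v := by positivity
    rw [integral_const_mul, Real.integral_rpow_mul_exp_neg_mul_Ioi hb hv1,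
      one_div, Real.inv_rpow hv1.le, Real.rpow_neg hv1.le, mul_div_cancel₀ s two_ne_zero]
    ring
  rw [setIntegral_congr_fun measurableSet_Ioi fun x hx => inner_integral_eq a s hx,
    integral_integral_swap, setIntegral_congr_fun measurableSet_Ioi hgamma, integral_const_mul]
  refine (integrable_prod_iff' ?_).2 ⟨?_, ?_⟩
  · refine Measurable.aestronglyMeasurable ?_
    simp only [Function.uncurry_def]
    fun_prop
  · filter_upwards [ae_restrict_mem measurableSet_Ioi] with v (hv : 0 < v)
    refine .of_integral_ne_zero ?_
    simp only [Function.uncurry_apply_pair]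
    rw [hgamma v hv]
    positivity
  · have h := (integrableOn_and_integral_Ioi ha (s / 2)).1.const_mul
      (Real.Gamma (2 * a + s / 2))
    refine IntegrableOn.congr_fun h (fun v (hv : 0 < v) => ?_) measurableSet_Ioi
    rw [← hgamma v hv]
    refine setIntegral_congr_fun measurableSet_Ioi fun x (hx : 0 < x) => ?_
    simp only [Function.uncurry_apply_pair]
    rw [Real.norm_of_nonneg (by positivity)]

/-- Mellin-transform form of the identity in law
`√Γ_a + √Γ_a = √(Γ_{2a} × (1 + √B_{a,1/2}))`. -/
theorem sqrt_gamma_sum_mellin (a s : ℝ) (ha : 0 < a) (hs : -4 * a < s) :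
    (1 / Real.Gamma a ^ 2) *
        ∫ x in Ioi (0 : ℝ), ∫ y in Ioi (0 : ℝ),
          (Real.sqrt x + Real.sqrt y) ^ s * x ^ (a - 1) * y ^ (a - 1) * Real.exp (-x - y)
      = (Real.Gamma (2 * a + s / 2) / Real.Gamma (2 * a))
        * (Real.Gamma (a + 1 / 2) / (Real.Gamma a * Real.Gamma (1 / 2)))
        * ∫ u in (0 : ℝ)..1, u ^ (a - 1) * (1 - u) ^ (-(1 / 2) : ℝ)
            * (1 + Real.sqrt u) ^ (s / 2) := by
  rw [double_integral_eq ha hs, (integrableOn_and_integral_Ioi ha (s / 2)).2,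
    intervalIntegral.integral_of_le zero_le_one, integral_Ioc_eq_integral_Ioo]
  have hdup := Real.Gamma_mul_Gamma_add_half a
  have hpow : (2 : ℝ) ^ (1 - 2 * a) = 2 * (4 ^ a)⁻¹ := by
    rw [Real.rpow_sub two_pos, Real.rpow_one, Real.rpow_mul zero_le_two]
    norm_num [div_eq_mul_inv]
  rw [hpow, ← Real.Gamma_one_half_eq] at hdup
  have h1 := Real.Gamma_pos_of_pos ha
  have h2 := Real.Gamma_pos_of_pos (mul_pos two_pos ha)
  have h3 : 0 < Real.Gamma (1 / 2) := Real.Gamma_pos_of_pos (by norm_num)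
  have hhalf : Real.Gamma (a + 1 / 2)
      = Real.Gamma (2 * a) * (2 * (4 ^ a)⁻¹) * Real.Gamma (1 / 2) / Real.Gamma a := by
    rw [eq_div_iff h1.ne', ← hdup, mul_comm]
  rw [hhalf]
  field_simp
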